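/- Let A be a real s×s lower-triangular matrix whose diagonal entries are all strictly positive. Then there exists a constant C > 0 such that ‖(I − zA)⁻¹‖ ≤ C for every z ∈ ℂ with Re(z) ≤ 0. -/

import Mathlib

open Matrix

attribute [local instance] Matrix.linftyOpNormedAddCommGroup

/-- On the closed left half-plane `|1 - z a|` is bounded below by a multiple of `1 + |z|`. -/
lemma one_add_norm_le_mul_norm_one_sub_mul {a : ℝ} (ha : 0 < a) {z : ℂ} (hz : z.re ≤ 0) :
    1 + ‖z‖ ≤ (1 + a⁻¹) * ‖1 - z * (a : ℂ)‖ := by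
  have hsq : ‖1 - z * (a : ℂ)‖ ^ 2 = 1 - 2 * a * z.re + a ^ 2 * ‖z‖ ^ 2 := by
    simp only [← Complex.normSq_eq_norm_sq, Complex.normSq_apply]
    simp
    ring
  have hre : 0 ≤ -(a * z.re) := by nlinarith
  have h1 : 1 ≤ ‖1 - z * (a : ℂ)‖ :=
    le_of_sq_le_sq (by rw [hsq]; nlinarith [sq_nonneg (a * ‖z‖)]) (norm_nonneg _)
  have h2 : a * ‖z‖ ≤ ‖1 - z * (a : ℂ)‖ :=
    le_of_sq_le_sq (by rw [hsq]; nlinarith) (norm_nonneg _)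
  have h3 : ‖z‖ ≤ a⁻¹ * ‖1 - z * (a : ℂ)‖ := by
    rwa [← div_eq_inv_mul, le_div_iff₀' ha]
  linarith

/-- Entrywise bounds on a matrix bound the entries of its adjugate. -/
lemma norm_adjugate_apply_le {n : Type*} [Fintype n] [DecidableEq n] {B : Matrix n n ℂ} {r : ℝ}
    (hr : 1 ≤ r) (hB : ∀ i j, ‖B i j‖ ≤ r) (i j : n) :
    ‖B.adjugate i j‖ ≤ (Fintype.card n).factorial * r ^ Fintype.card n := by
  rw [adjugate_apply]
  have h := Matrix.det_le (A := B.updateRow j (Pi.single i 1))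
    (abv := NormedField.toAbsoluteValue ℂ) (x := r) (fun k l => by
      change ‖B.updateRow j (Pi.single i 1) k l‖ ≤ r
      rw [updateRow_apply]
      split_ifs
      · rw [Pi.single_apply]
        split_ifs
        · simpa using hr
        · simpa using zero_le_one.trans hr
      · exact hB k l)
  rw [nsmul_eq_mul] at h
  exact h

/-- A uniform bound on the entries bounds the `ℓ^∞` operator norm. -/
lemma linfty_opNorm_le_card_mul {n : Type*} [Fintype n] {B : Matrix n n ℂ} {r : ℝ}
    (hr : 0 ≤ r) (hB : ∀ i j, ‖B i j‖ ≤ r) : ‖B‖ ≤ Fintype.card n * r := by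
  lift r to NNReal using hr
  rw [linfty_opNorm_def]
  have h : (Finset.univ.sup fun i => ∑ j, ‖B i j‖₊) ≤ Fintype.card n * r := by
    refine Finset.sup_le fun i _ => ?_
    refine (Finset.sum_le_card_nsmul _ _ r fun j _ => hB i j).trans ?_
    simp
  exact_mod_cast h

/-- For a lower-triangular real matrix `A` with strictly positive diagonal,
the resolvent `(I − zA)⁻¹` is uniformly bounded on the closed left
half-plane. -/
theorem stmt_6 (s : ℕ) (A : Matrix (Fin s) (Fin s) ℝ)
    (hlow : ∀ i j : Fin s, i < j → A i j = 0)
    (hdiag : ∀ i : Fin s, 0 < A i i) :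
    ∃ C : ℝ, 0 < C ∧ ∀ z : ℂ, z.re ≤ 0 →
      ‖((1 : Matrix (Fin s) (Fin s) ℂ) - z • A.map Complex.ofReal)⁻¹‖ ≤ C := by
  set M : ℝ := 1 + ∑ i, ∑ j, |A i j|
  set P : ℝ := ∏ i, (1 + (A i i)⁻¹) with hP
  have hM1 : 1 ≤ M := le_add_of_nonneg_right (by positivity)
  have hP0 : 0 < P := Finset.prod_pos fun i _ => by have := hdiag i; positivity
  have hAM : ∀ i j, |A i j| ≤ M := fun i j => by
    have h1 : |A i j| ≤ ∑ j, |A i j| :=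
      Finset.single_le_sum (f := fun j => |A i j|) (fun _ _ => abs_nonneg _) (Finset.mem_univ j)
    have h2 : ∑ j, |A i j| ≤ ∑ i, ∑ j, |A i j| :=
      Finset.single_le_sum (f := fun i => ∑ j, |A i j|) (fun _ _ => by positivity)
        (Finset.mem_univ i)
    linarith
  set K : ℝ := P * (s.factorial * M ^ s) with hK
  have hK0 : 0 ≤ K := by positivity
  refine ⟨s * K + 1, by positivity, fun z hz => ?_⟩
  set B : Matrix (Fin s) (Fin s) ℂ := 1 - z • A.map Complex.ofReal with hB
  have hdet : B.det = ∏ i, (1 - z * (A i i : ℂ)) := by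
    rw [det_of_isLowerTriangular B fun i j hij => by
      have hij : i < j := hij
      simp [hB, hlow i j hij, one_apply_ne hij.ne]]
    simp [hB]
  have hdet_le : (1 + ‖z‖) ^ s ≤ P * ‖B.det‖ := by
    rw [hdet, norm_prod, hP, ← Finset.prod_mul_distrib]
    calc (1 + ‖z‖) ^ s = ∏ _i : Fin s, (1 + ‖z‖) := by simp
      _ ≤ _ := Finset.prod_le_prod (fun _ _ => by positivity) fun i _ =>
        one_add_norm_le_mul_norm_one_sub_mul (hdiag i) hz
  have hdet_pos : 0 < ‖B.det‖ :=
    pos_of_mul_pos_right ((by positivity : 0 < (1 + ‖z‖) ^ s).trans_le hdet_le) hP0.le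
  have hentry : ∀ i j, ‖B i j‖ ≤ M * (1 + ‖z‖) := fun i j => by
    have h1 : ‖(1 : Matrix (Fin s) (Fin s) ℂ) i j‖ ≤ 1 := by
      rw [one_apply]; split_ifs <;> simp
    calc ‖B i j‖ ≤ ‖(1 : Matrix (Fin s) (Fin s) ℂ) i j‖ + ‖z * (A i j : ℂ)‖ := by
          simpa [hB] using norm_sub_le ((1 : Matrix (Fin s) (Fin s) ℂ) i j) (z * (A i j : ℂ))
      _ ≤ 1 + ‖z‖ * M := by
          rw [norm_mul, Complex.norm_real, Real.norm_eq_abs]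
          gcongr
          exact hAM i j
      _ ≤ M * (1 + ‖z‖) := by linarith
  have hinv : ∀ i j, ‖B⁻¹ i j‖ ≤ K := fun i j => by
    have hadj := norm_adjugate_apply_le
      (one_le_mul_of_one_le_of_one_le hM1 (le_add_of_nonneg_right (norm_nonneg z))) hentry i j
    rw [inv_def, Matrix.smul_apply, smul_eq_mul, norm_mul, Ring.inverse_eq_inv', norm_inv,
      ← div_eq_inv_mul, div_le_iff₀ hdet_pos]
    calc ‖B.adjugate i j‖ ≤ s.factorial * (M * (1 + ‖z‖)) ^ s := by simpa using hadj
      _ = s.factorial * M ^ s * (1 + ‖z‖) ^ s := by rw [mul_pow, mul_assoc]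
      _ ≤ s.factorial * M ^ s * (P * ‖B.det‖) := by gcongr
      _ = K * ‖B.det‖ := by rw [hK]; ring
  have hnorm := linfty_opNorm_le_card_mul hK0 hinv
  rw [Fintype.card_fin] at hnorm
  linarith
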